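/- Every ontology-mediated instance query q = (O, κ), where O is an LTL_bool^□○ ontology and κ an arbitrary temporal concept, is FO(RPR)-rewritable: there is a constant-free FO(RPR)-formula q(t) with one free variable t such that ans(q, A) = {ℓ ∈ tem(A) : S_A ⊨ q(ℓ)} for every data instance A. -/

import Mathlib

namespace LTLOMQ

/-! ## Temporal concepts (LTL formulas) and their semantics over (ℤ,<) -/

/-- Temporal concepts: arbitrary LTL formulas over atomic concepts indexed by `ℕ`. -/
inductive TC : Type where
  | top : TC
  | atom : ℕ → TC
  | neg : TC → TC
  | and : TC → TC → TC
  | or : TC → TC → TC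
  | nextF : TC → TC
  | diamF : TC → TC
  | boxF : TC → TC
  | untl : TC → TC → TC
  | nextP : TC → TC
  | diamP : TC → TC
  | boxP : TC → TC
  | since : TC → TC → TC

/-- A temporal interpretation assigns to each atomic concept a subset of ℤ. -/
abbrev Itp : Type := ℕ → Set ℤ

/-- The extension of a temporal concept in an interpretation
(strict semantics over `(ℤ,<)`). -/
def TC.sem (M : Itp) : TC → Set ℤ
  | .top => Set.univ
  | .atom a => M a
  | .neg C => (TC.sem M C)ᶜ
  | .and C D => TC.sem M C ∩ TC.sem M D
  | .or C D => TC.sem M C ∪ TC.sem M D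
  | .nextF C => {n | n + 1 ∈ TC.sem M C}
  | .diamF C => {n | ∃ k, n < k ∧ k ∈ TC.sem M C}
  | .boxF C => {n | ∀ k, n < k → k ∈ TC.sem M C}
  | .untl C D => {n | ∃ k, n < k ∧ k ∈ TC.sem M D ∧ ∀ m, n < m → m < k → m ∈ TC.sem M C}
  | .nextP C => {n | n - 1 ∈ TC.sem M C}
  | .diamP C => {n | ∃ k, k < n ∧ k ∈ TC.sem M C}
  | .boxP C => {n | ∀ k, k < n → k ∈ TC.sem M C}
  | .since C D => {n | ∃ k, k < n ∧ k ∈ TC.sem M D ∧ ∀ m, k < m → m < n → m ∈ TC.sem M C}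

/-- Basic temporal concepts: built from atomic concepts using ○F, ○P, □F, □P. -/
inductive TC.IsBasic : TC → Prop
  | atom (a : ℕ) : TC.IsBasic (.atom a)
  | nextF {C : TC} : TC.IsBasic C → TC.IsBasic (.nextF C)
  | nextP {C : TC} : TC.IsBasic C → TC.IsBasic (.nextP C)
  | boxF {C : TC} : TC.IsBasic C → TC.IsBasic (.boxF C)
  | boxP {C : TC} : TC.IsBasic C → TC.IsBasic (.boxP C)

/-- Basic temporal concepts using □F and □P only. -/
inductive TC.IsBasicBox : TC → Prop
  | atom (a : ℕ) : TC.IsBasicBox (.atom a)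
  | boxF {C : TC} : TC.IsBasicBox C → TC.IsBasicBox (.boxF C)
  | boxP {C : TC} : TC.IsBasicBox C → TC.IsBasicBox (.boxP C)

/-- Basic temporal concepts using ○F and ○P only. -/
inductive TC.IsBasicNext : TC → Prop
  | atom (a : ℕ) : TC.IsBasicNext (.atom a)
  | nextF {C : TC} : TC.IsBasicNext C → TC.IsBasicNext (.nextF C)
  | nextP {C : TC} : TC.IsBasicNext C → TC.IsBasicNext (.nextP C)

/-- Positive temporal concepts: no occurrences of ¬. -/
inductive TC.IsPositive : TC → Prop
  | top : TC.IsPositive .top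
  | atom (a : ℕ) : TC.IsPositive (.atom a)
  | and {C D : TC} : TC.IsPositive C → TC.IsPositive D → TC.IsPositive (.and C D)
  | or {C D : TC} : TC.IsPositive C → TC.IsPositive D → TC.IsPositive (.or C D)
  | nextF {C : TC} : TC.IsPositive C → TC.IsPositive (.nextF C)
  | diamF {C : TC} : TC.IsPositive C → TC.IsPositive (.diamF C)
  | boxF {C : TC} : TC.IsPositive C → TC.IsPositive (.boxF C)
  | untl {C D : TC} : TC.IsPositive C → TC.IsPositive D → TC.IsPositive (.untl C D)
  | nextP {C : TC} : TC.IsPositive C → TC.IsPositive (.nextP C)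
  | diamP {C : TC} : TC.IsPositive C → TC.IsPositive (.diamP C)
  | boxP {C : TC} : TC.IsPositive C → TC.IsPositive (.boxP C)
  | since {C D : TC} : TC.IsPositive C → TC.IsPositive D → TC.IsPositive (.since C D)

/-- Prior-LTL formulas: Boolean connectives and □P, ◇P, □F, ◇F only. -/
inductive TC.IsPrior : TC → Prop
  | atom (a : ℕ) : TC.IsPrior (.atom a)
  | neg {C : TC} : TC.IsPrior C → TC.IsPrior (.neg C)
  | and {C D : TC} : TC.IsPrior C → TC.IsPrior D → TC.IsPrior (.and C D)
  | or {C D : TC} : TC.IsPrior C → TC.IsPrior D → TC.IsPrior (.or C D)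
  | boxF {C : TC} : TC.IsPrior C → TC.IsPrior (.boxF C)
  | boxP {C : TC} : TC.IsPrior C → TC.IsPrior (.boxP C)
  | diamF {C : TC} : TC.IsPrior C → TC.IsPrior (.diamF C)
  | diamP {C : TC} : TC.IsPrior C → TC.IsPrior (.diamP C)

/-- Number of occurrences of temporal operators in a temporal concept. -/
def TC.tempOps : TC → ℕ
  | .top => 0
  | .atom _ => 0
  | .neg C => TC.tempOps C
  | .and C D => TC.tempOps C + TC.tempOps D
  | .or C D => TC.tempOps C + TC.tempOps D
  | .nextF C => TC.tempOps C + 1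
  | .diamF C => TC.tempOps C + 1
  | .boxF C => TC.tempOps C + 1
  | .untl C D => TC.tempOps C + TC.tempOps D + 1
  | .nextP C => TC.tempOps C + 1
  | .diamP C => TC.tempOps C + 1
  | .boxP C => TC.tempOps C + 1
  | .since C D => TC.tempOps C + TC.tempOps D + 1

/-- Number of occurrences of symbols in a temporal concept. -/
def TC.size : TC → ℕ
  | .top => 1
  | .atom _ => 1
  | .neg C => TC.size C + 1
  | .and C D => TC.size C + TC.size D + 1
  | .or C D => TC.size C + TC.size D + 1
  | .nextF C => TC.size C + 1
  | .diamF C => TC.size C + 1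
  | .boxF C => TC.size C + 1
  | .untl C D => TC.size C + TC.size D + 1
  | .nextP C => TC.size C + 1
  | .diamP C => TC.size C + 1
  | .boxP C => TC.size C + 1
  | .since C D => TC.size C + TC.size D + 1

/-- The set of subconcepts of a temporal concept. -/
def TC.subs : TC → Set TC
  | .top => {.top}
  | .atom a => {.atom a}
  | .neg C => insert (.neg C) (TC.subs C)
  | .and C D => insert (.and C D) (TC.subs C ∪ TC.subs D)
  | .or C D => insert (.or C D) (TC.subs C ∪ TC.subs D)
  | .nextF C => insert (.nextF C) (TC.subs C)
  | .diamF C => insert (.diamF C) (TC.subs C)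
  | .boxF C => insert (.boxF C) (TC.subs C)
  | .untl C D => insert (.untl C D) (TC.subs C ∪ TC.subs D)
  | .nextP C => insert (.nextP C) (TC.subs C)
  | .diamP C => insert (.diamP C) (TC.subs C)
  | .boxP C => insert (.boxP C) (TC.subs C)
  | .since C D => insert (.since C D) (TC.subs C ∪ TC.subs D)

/-- The set of atomic concepts occurring in a temporal concept. -/
def TC.atoms : TC → Set ℕ
  | .top => ∅
  | .atom a => {a}
  | .neg C => TC.atoms C
  | .and C D => TC.atoms C ∪ TC.atoms D
  | .or C D => TC.atoms C ∪ TC.atoms D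
  | .nextF C => TC.atoms C
  | .diamF C => TC.atoms C
  | .boxF C => TC.atoms C
  | .untl C D => TC.atoms C ∪ TC.atoms D
  | .nextP C => TC.atoms C
  | .diamP C => TC.atoms C
  | .boxP C => TC.atoms C
  | .since C D => TC.atoms C ∪ TC.atoms D

/-! ## Clauses, ontologies, data instances -/

/-- A clause `C₁ ∧ … ∧ C_k → C_{k+1} ∨ … ∨ C_{k+m}`. -/
structure Clause : Type where
  prem : List TC
  concl : List TC

/-- A clause is true in `M` if the intersection of the extensions of the premises
is contained in the union of the extensions of the conclusions. -/
def Clause.holds (M : Itp) (cl : Clause) : Prop :=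
  ∀ n : ℤ, (∀ C ∈ cl.prem, n ∈ TC.sem M C) → ∃ C ∈ cl.concl, n ∈ TC.sem M C

/-- An ontology is a finite set (list) of clauses. -/
abbrev Ontology : Type := List Clause

def Clause.AllBasic (cl : Clause) : Prop :=
  (∀ C ∈ cl.prem, C.IsBasic) ∧ (∀ C ∈ cl.concl, C.IsBasic)

def Clause.AllBasicBox (cl : Clause) : Prop :=
  (∀ C ∈ cl.prem, C.IsBasicBox) ∧ (∀ C ∈ cl.concl, C.IsBasicBox)

def Clause.AllBasicNext (cl : Clause) : Prop :=
  (∀ C ∈ cl.prem, C.IsBasicNext) ∧ (∀ C ∈ cl.concl, C.IsBasicNext)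

/-- Horn: at most one disjunct in the conclusion. -/
def Clause.Horn (cl : Clause) : Prop := cl.concl.length ≤ 1

/-- Krom (binary): at most two concepts altogether. -/
def Clause.Krom (cl : Clause) : Prop := cl.prem.length + cl.concl.length ≤ 2

/-- LTL_bool^□○ ontologies. -/
def Ontology.BoolBoxNext (O : Ontology) : Prop := ∀ cl ∈ O, cl.AllBasic
/-- LTL_bool^□ ontologies. -/
def Ontology.BoolBox (O : Ontology) : Prop := ∀ cl ∈ O, cl.AllBasicBox
/-- LTL_krom^○ ontologies. -/
def Ontology.KromNext (O : Ontology) : Prop := ∀ cl ∈ O, cl.AllBasicNext ∧ cl.Krom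
/-- LTL_krom^□○ ontologies. -/
def Ontology.KromBoxNext (O : Ontology) : Prop := ∀ cl ∈ O, cl.AllBasic ∧ cl.Krom
/-- LTL_horn^□○ ontologies. -/
def Ontology.HornBoxNext (O : Ontology) : Prop := ∀ cl ∈ O, cl.AllBasic ∧ cl.Horn
/-- LTL_horn^□ ontologies. -/
def Ontology.HornBox (O : Ontology) : Prop := ∀ cl ∈ O, cl.AllBasicBox ∧ cl.Horn
/-- LTL_core^□○ ontologies. -/
def Ontology.CoreBoxNext (O : Ontology) : Prop := ∀ cl ∈ O, cl.AllBasic ∧ cl.Horn ∧ cl.Krom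

/-- Number of occurrences of symbols in a clause. -/
def Clause.size (cl : Clause) : ℕ :=
  (cl.prem.map TC.size).sum + (cl.concl.map TC.size).sum + 1

/-- Number of occurrences of symbols in an ontology. -/
def Ontology.size (O : Ontology) : ℕ := (O.map Clause.size).sum

/-- The atomic concept `a` occurs in the ontology `O`. -/
def Ontology.occurs (O : Ontology) (a : ℕ) : Prop :=
  ∃ cl ∈ O, (∃ C ∈ cl.prem, a ∈ C.atoms) ∨ (∃ C ∈ cl.concl, a ∈ C.atoms)

/-- The set of subconcepts of (concepts occurring in) an ontology. -/
def Ontology.subs (O : Ontology) : Set TC :=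
  {C | ∃ cl ∈ O, ∃ D : TC, (D ∈ cl.prem ∨ D ∈ cl.concl) ∧ C ∈ D.subs}

/-- A flat concept: an atomic concept, or a single ○F or ○P applied to an atomic concept. -/
def TC.IsFlat : TC → Prop
  | .atom _ => True
  | .nextF (.atom _) => True
  | .nextP (.atom _) => True
  | _ => False

/-- An ontology without nested temporal operators. -/
def Ontology.Flat (O : Ontology) : Prop :=
  ∀ cl ∈ O, (∀ C ∈ cl.prem, C.IsFlat) ∧ (∀ C ∈ cl.concl, C.IsFlat)

/-- A data instance: a finite nonempty set of timestamped atoms, normalized so that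
the minimal timestamp is 0 and the maximal one is ≥ 1. -/
structure DataInstance : Type where
  atoms : Finset (ℕ × ℤ)
  nonneg : ∀ p ∈ atoms, 0 ≤ p.2
  has_zero : ∃ p ∈ atoms, p.2 = 0
  has_one : ∃ p ∈ atoms, 1 ≤ p.2

theorem DataInstance.ts_nonempty (A : DataInstance) :
    (A.atoms.image Prod.snd).Nonempty := by
  obtain ⟨p, hp, -⟩ := A.has_zero
  exact ⟨p.2, Finset.mem_image_of_mem _ hp⟩

/-- min A: the minimal timestamp occurring in the data instance (equal to 0). -/
def DataInstance.minT (A : DataInstance) : ℤ :=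
  (A.atoms.image Prod.snd).min' A.ts_nonempty

/-- max A: the maximal timestamp occurring in the data instance. -/
def DataInstance.maxT (A : DataInstance) : ℤ :=
  (A.atoms.image Prod.snd).max' A.ts_nonempty

/-- The active temporal domain tem(A). -/
def DataInstance.tem (A : DataInstance) : Set ℤ := Set.Icc A.minT A.maxT

/-- The interpretation of atomic concepts in the first-order structure S_A. -/
def DataInstance.itp (A : DataInstance) : Itp := fun a => {n | (a, n) ∈ A.atoms}

/-- `M` is a model of the knowledge base `(O, A)`. -/
def IsModel (M : Itp) (O : Ontology) (A : DataInstance) : Prop :=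
  (∀ cl ∈ O, cl.holds M) ∧ ∀ p ∈ A.atoms, p.2 ∈ M p.1

/-- The ontology `O` is consistent. -/
def Ontology.Consistent (O : Ontology) : Prop := ∃ M : Itp, ∀ cl ∈ O, cl.holds M

/-- The data instance `A` is consistent with `O`. -/
def ConsistentWith (O : Ontology) (A : DataInstance) : Prop := ∃ M : Itp, IsModel M O A

/-- Certain answers to the OMIQ `(O, κ)` over `A` (within the active domain). -/
def certAns (O : Ontology) (κ : TC) (A : DataInstance) : Set ℤ :=
  {ℓ | ℓ ∈ A.tem ∧ ∀ M : Itp, IsModel M O A → ℓ ∈ TC.sem M κ}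

/-- Certain answers to the OMIQ `(O, κ)` over `A` and ℤ. -/
def certAnsZ (O : Ontology) (κ : TC) (A : DataInstance) : Set ℤ :=
  {ℓ | ∀ M : Itp, IsModel M O A → ℓ ∈ TC.sem M κ}

/-! ## First-order, MSO and FO(RPR) formulas over the temporal structures -/

/-- Formulas of the target languages: first-order variables are indexed by `ℕ`,
as are second-order (set) variables and the recursively defined relation variables
of FO(RPR).  The constructors `qprev j` and `qapp j x` stand for `Q_j(t-1)` (inside
a recursive definition block) and `Q_j(x)`, respectively; `rpr n Θ tv ψ` is the
relational-primitive-recursion construct `[Q₁(t) ≡ Θ₁; …; Q_n(t) ≡ Θ_n] ψ`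
with recursion variable `tv`. -/
inductive Fml : Type where
  | falsum : Fml
  | atom : ℕ → ℕ → Fml        -- A(x)
  | lt : ℕ → ℕ → Fml          -- x < y
  | eq : ℕ → ℕ → Fml          -- x = y
  | succ : ℕ → ℕ → Fml        -- x = y + 1
  | mod : ℕ → ℕ → Fml         -- x ≡ 0 (mod n)
  | svar : ℕ → ℕ → Fml        -- X(x), X a set variable
  | qprev : ℕ → Fml           -- Q_j(t−1)
  | qapp : ℕ → ℕ → Fml        -- Q_j(x)
  | neg : Fml → Fml
  | and : Fml → Fml → Fml
  | or : Fml → Fml → Fml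
  | ex : ℕ → Fml → Fml
  | all : ℕ → Fml → Fml
  | exS : ℕ → Fml → Fml       -- second-order ∃
  | allS : ℕ → Fml → Fml      -- second-order ∀
  | rpr : (n : ℕ) → (Fin n → Fml) → ℕ → Fml → Fml

/-- Evaluation of a formula over the structure with (active) domain `D ⊆ ℤ`
and interpretation `I` of the unary predicates; `env` assigns first-order
variables, `senv` set variables, `prev` the placeholders `Q_j(t-1)` and
`Q` the defined relation variables. First-order quantifiers range over `D`,
second-order quantifiers over subsets of `D`. -/
def Fml.eval (D : Set ℤ) (I : ℕ → Set ℤ) :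
    Fml → (ℕ → ℤ) → (ℕ → Set ℤ) → (ℕ → Prop) → (ℕ → ℤ → Prop) → Prop
  | .falsum, _, _, _, _ => False
  | .atom a x, env, _, _, _ => env x ∈ I a
  | .lt x y, env, _, _, _ => env x < env y
  | .eq x y, env, _, _, _ => env x = env y
  | .succ x y, env, _, _, _ => env x = env y + 1
  | .mod n x, env, _, _, _ => (n : ℤ) ∣ env x
  | .svar X x, env, senv, _, _ => env x ∈ senv X
  | .qprev j, _, _, prev, _ => prev j
  | .qapp j x, env, _, _, Q => Q j (env x)
  | .neg φ, env, senv, prev, Q => ¬ Fml.eval D I φ env senv prev Q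
  | .and φ ψ, env, senv, prev, Q =>
      Fml.eval D I φ env senv prev Q ∧ Fml.eval D I ψ env senv prev Q
  | .or φ ψ, env, senv, prev, Q =>
      Fml.eval D I φ env senv prev Q ∨ Fml.eval D I ψ env senv prev Q
  | .ex x φ, env, senv, prev, Q =>
      ∃ d ∈ D, Fml.eval D I φ (Function.update env x d) senv prev Q
  | .all x φ, env, senv, prev, Q =>
      ∀ d ∈ D, Fml.eval D I φ (Function.update env x d) senv prev Q
  | .exS X φ, env, senv, prev, Q =>
      ∃ S : Set ℤ, S ⊆ D ∧ Fml.eval D I φ env (Function.update senv X S) prev Q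
  | .allS X φ, env, senv, prev, Q =>
      ∀ S : Set ℤ, S ⊆ D → Fml.eval D I φ env (Function.update senv X S) prev Q
  | .rpr n Θ tv ψ, env, senv, prev, Q =>
      -- the semantics of each Θ_j, as a function of the first-order environment
      -- and of the truth values of the `Q_j(t−1)` placeholders
      let f : Fin n → (ℕ → ℤ) → (ℕ → Prop) → Prop :=
        fun j env' prev' => Fml.eval D I (Θ j) env' senv prev' Q
      -- the recursively computed truth values of `Q_j` at time `k` (recursion on k from 0)
      let recQ : ℕ → Fin n → Prop := fun k =>
        Nat.rec (fun j => f j (Function.update env tv 0) (fun _ => False))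
          (fun m ih j => f j (Function.update env tv ((m : ℤ) + 1))
            (fun i => ∃ h : i < n, ih ⟨i, h⟩)) k
      Fml.eval D I ψ env senv prev
        (fun j z => ∃ h : j < n, 0 ≤ z ∧ recQ z.toNat ⟨j, h⟩)

/-- Free first-order variables of a formula. -/
def Fml.fvars : Fml → Set ℕ
  | .falsum => ∅
  | .atom _ x => {x}
  | .lt x y => {x, y}
  | .eq x y => {x, y}
  | .succ x y => {x, y}
  | .mod _ x => {x}
  | .svar _ x => {x}
  | .qprev _ => ∅
  | .qapp _ x => {x}
  | .neg φ => Fml.fvars φ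
  | .and φ ψ => Fml.fvars φ ∪ Fml.fvars ψ
  | .or φ ψ => Fml.fvars φ ∪ Fml.fvars ψ
  | .ex x φ => Fml.fvars φ \ {x}
  | .all x φ => Fml.fvars φ \ {x}
  | .exS _ φ => Fml.fvars φ
  | .allS _ φ => Fml.fvars φ
  | .rpr n Θ tv ψ => (⋃ j : Fin n, Fml.fvars (Θ j) \ {tv}) ∪ Fml.fvars ψ

/-- FO(<)-formulas: first-order logic with the built-in linear order
(and the definable equality predicate); no constants, no arithmetic. -/
def Fml.IsFOlt : Fml → Prop
  | .falsum => True
  | .atom _ _ => True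
  | .lt _ _ => True
  | .eq _ _ => True
  | .neg φ => Fml.IsFOlt φ
  | .and φ ψ => Fml.IsFOlt φ ∧ Fml.IsFOlt ψ
  | .or φ ψ => Fml.IsFOlt φ ∧ Fml.IsFOlt ψ
  | .ex _ φ => Fml.IsFOlt φ
  | .all _ φ => Fml.IsFOlt φ
  | _ => False

/-- FO(<,≡)-formulas: FO(<) extended with the predicates `t ≡ 0 (mod n)`, `n > 1`. -/
def Fml.IsFOltMod : Fml → Prop
  | .falsum => True
  | .atom _ _ => True
  | .lt _ _ => True
  | .eq _ _ => True
  | .mod n _ => 2 ≤ n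
  | .neg φ => Fml.IsFOltMod φ
  | .and φ ψ => Fml.IsFOltMod φ ∧ Fml.IsFOltMod ψ
  | .or φ ψ => Fml.IsFOltMod φ ∧ Fml.IsFOltMod ψ
  | .ex _ φ => Fml.IsFOltMod φ
  | .all _ φ => Fml.IsFOltMod φ
  | _ => False

/-- MSO(<)-formulas: FO(<) extended with set variables and second-order quantifiers. -/
def Fml.IsMSO : Fml → Prop
  | .falsum => True
  | .atom _ _ => True
  | .lt _ _ => True
  | .eq _ _ => True
  | .svar _ _ => True
  | .neg φ => Fml.IsMSO φ
  | .and φ ψ => Fml.IsMSO φ ∧ Fml.IsMSO ψ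
  | .or φ ψ => Fml.IsMSO φ ∧ Fml.IsMSO ψ
  | .ex _ φ => Fml.IsMSO φ
  | .all _ φ => Fml.IsMSO φ
  | .exS _ φ => Fml.IsMSO φ
  | .allS _ φ => Fml.IsMSO φ
  | _ => False

/-- FO(RPR)-formulas: FO(<) extended with successor and relational primitive recursion. -/
def Fml.IsRPR : Fml → Prop
  | .falsum => True
  | .atom _ _ => True
  | .lt _ _ => True
  | .eq _ _ => True
  | .succ _ _ => True
  | .qprev _ => True
  | .qapp _ _ => True
  | .neg φ => Fml.IsRPR φ
  | .and φ ψ => Fml.IsRPR φ ∧ Fml.IsRPR ψ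
  | .or φ ψ => Fml.IsRPR φ ∧ Fml.IsRPR ψ
  | .ex _ φ => Fml.IsRPR φ
  | .all _ φ => Fml.IsRPR φ
  | .rpr n Θ _ ψ => (∀ j : Fin n, Fml.IsRPR (Θ j)) ∧ Fml.IsRPR ψ
  | _ => False

/-- MFO(<)-formulas: monadic first-order formulas built from atoms `A(t)`,
`t < t'`, `t = t'` and `t = t' + 1`. -/
def Fml.IsMFO : Fml → Prop
  | .falsum => True
  | .atom _ _ => True
  | .lt _ _ => True
  | .eq _ _ => True
  | .succ _ _ => True
  | .neg φ => Fml.IsMFO φ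
  | .and φ ψ => Fml.IsMFO φ ∧ Fml.IsMFO ψ
  | .or φ ψ => Fml.IsMFO φ ∧ Fml.IsMFO ψ
  | .ex _ φ => Fml.IsMFO φ
  | .all _ φ => Fml.IsMFO φ
  | _ => False

/-- Quasi-positive MFO(<)-formulas: built from atoms `A(t)`, `t < t'`, `t = t'`,
`t = t' + 1` (and ⊥) using ∧, ∨, ∃, ∀ as well as guarded universal quantification
`∀y (x < y < z → φ)`, `∀y (x < y → φ)`, `∀y (y < z → φ)`
(the guarded implications are encoded via `¬guard ∨ φ`). -/
inductive Fml.IsQP : Fml → Prop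
  | falsum : Fml.IsQP .falsum
  | atom (a x : ℕ) : Fml.IsQP (.atom a x)
  | lt (x y : ℕ) : Fml.IsQP (.lt x y)
  | eq (x y : ℕ) : Fml.IsQP (.eq x y)
  | succ (x y : ℕ) : Fml.IsQP (.succ x y)
  | and {φ ψ : Fml} : Fml.IsQP φ → Fml.IsQP ψ → Fml.IsQP (.and φ ψ)
  | or {φ ψ : Fml} : Fml.IsQP φ → Fml.IsQP ψ → Fml.IsQP (.or φ ψ)
  | ex (x : ℕ) {φ : Fml} : Fml.IsQP φ → Fml.IsQP (.ex x φ)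
  | all (x : ℕ) {φ : Fml} : Fml.IsQP φ → Fml.IsQP (.all x φ)
  | allBtw (y x z : ℕ) {φ : Fml} : Fml.IsQP φ →
      Fml.IsQP (.all y (.or (.neg (.and (.lt x y) (.lt y z))) φ))
  | allGt (y x : ℕ) {φ : Fml} : Fml.IsQP φ →
      Fml.IsQP (.all y (.or (.neg (.lt x y)) φ))
  | allLt (y z : ℕ) {φ : Fml} : Fml.IsQP φ →
      Fml.IsQP (.all y (.or (.neg (.lt y z)) φ))

/-- Evaluation in a structure with domain `D` and unary predicates `I`
(no set variables, placeholders or relation variables supplied). -/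
def Fml.evalIn (D : Set ℤ) (I : Itp) (φ : Fml) (env : ℕ → ℤ) : Prop :=
  Fml.eval D I φ env (fun _ => ∅) (fun _ => False) (fun _ _ => False)

/-- An MFO(<)-formula is monotone if it is preserved under adding time points
to the extensions of the atomic concepts. -/
def MonotoneFml (ψ : Fml) : Prop :=
  ∀ M₁ M₂ : Itp, (∀ a : ℕ, M₁ a ⊆ M₂ a) → ∀ env : ℕ → ℤ,
    Fml.evalIn Set.univ M₁ ψ env → Fml.evalIn Set.univ M₂ ψ env

/-! ## The canonical model of a Horn ontology and a data instance -/

/-- Atoms of the closure: ⊥ or `C(n)` for a (basic) temporal concept `C` and `n ∈ ℤ`. -/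
inductive EAtom : Type where
  | bot : EAtom
  | conc : TC → ℤ → EAtom

/-- One (non-recursive) application of the closure rules of the canonical model. -/
def clStep (O : Ontology) (Λ : Set EAtom) : Set EAtom :=
  Λ ∪
  {e | ∃ cl ∈ O, ∃ n : ℤ, (∀ C ∈ cl.prem, EAtom.conc C n ∈ Λ) ∧
        ((∃ C : TC, cl.concl = [C] ∧ e = EAtom.conc C n) ∨
          (cl.concl = [] ∧ e = EAtom.bot))} ∪
  {e | ∃ C : TC, ∃ n k : ℤ, n < k ∧ EAtom.conc (.boxF C) n ∈ Λ ∧ e = EAtom.conc C k} ∪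
  {e | ∃ C : TC, ∃ n : ℤ, (∀ k : ℤ, n < k → EAtom.conc C k ∈ Λ) ∧
        e = EAtom.conc (.boxF C) n} ∪
  {e | ∃ C : TC, ∃ n : ℤ, EAtom.conc (.nextF C) n ∈ Λ ∧ e = EAtom.conc C (n + 1)} ∪
  {e | ∃ C : TC, ∃ n : ℤ, EAtom.conc C (n + 1) ∈ Λ ∧ e = EAtom.conc (.nextF C) n} ∪
  {e | ∃ C : TC, ∃ n k : ℤ, k < n ∧ EAtom.conc (.boxP C) n ∈ Λ ∧ e = EAtom.conc C k} ∪
  {e | ∃ C : TC, ∃ n : ℤ, (∀ k : ℤ, k < n → EAtom.conc C k ∈ Λ) ∧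
        e = EAtom.conc (.boxP C) n} ∪
  {e | ∃ C : TC, ∃ n : ℤ, EAtom.conc (.nextP C) n ∈ Λ ∧ e = EAtom.conc C (n - 1)} ∪
  {e | ∃ C : TC, ∃ n : ℤ, EAtom.conc C (n - 1) ∈ Λ ∧ e = EAtom.conc (.nextP C) n}

/-- Transfinite iteration of the closure rules. -/
noncomputable def clIter (O : Ontology) (Λ : Set EAtom) (o : Ordinal.{0}) : Set EAtom :=
  Ordinal.limitRecOn o Λ (fun _ ih => clStep O ih)
    (fun o _ ih => ⋃ (o' : Ordinal.{0}), ⋃ (h : o' < o), ih o' h)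

/-- The atoms of a data instance, as a set of closure atoms. -/
def dataAtoms (A : DataInstance) : Set EAtom :=
  {e | ∃ p ∈ A.atoms, e = EAtom.conc (.atom p.1) p.2}

open Ordinal in
/-- The canonical model `C_{O,A}`: the closure of `A` under the rules,
iterated up to the first uncountable ordinal ω₁. -/
noncomputable def canon (O : Ontology) (A : DataInstance) : Set EAtom :=
  clIter O (dataAtoms A) (Ordinal.omega 1)

/-- The canonical model regarded as a temporal interpretation. -/
noncomputable def canonItp (O : Ontology) (A : DataInstance) : Itp :=
  fun a => {n | EAtom.conc (.atom a) n ∈ canon O A}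

/-- The type `τ_{O,A}(n)`: the set of subconcepts of `O` that hold at `n`
in the canonical model. -/
noncomputable def tau (O : Ontology) (A : DataInstance) (n : ℤ) : Set TC :=
  {C ∈ O.subs | n ∈ TC.sem (canonItp O A) C}

/-! ## Literals and the reachability relation ⇝ for Krom ontologies -/

/-- A simple literal: an atomic concept with a polarity. -/
abbrev Lit : Type := ℕ × Bool

/-- The temporal concept corresponding to a literal. -/
def Lit.toTC (L : Lit) : TC := if L.2 then .atom L.1 else .neg (.atom L.1)

def TC.iterF : ℕ → TC → TC
  | 0, C => C
  | k + 1, C => .nextF (TC.iterF k C)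

def TC.iterP : ℕ → TC → TC
  | 0, C => C
  | k + 1, C => .nextP (TC.iterP k C)

/-- `○^k C`: `k` occurrences of ○F if `k > 0`, of ○P if `k < 0`. -/
def TC.shift (k : ℤ) (C : TC) : TC :=
  if 0 ≤ k then TC.iterF k.toNat C else TC.iterP (-k).toNat C

/-- `(L₁,n₁) ⇝ (L₂,n₂)`: in every model of `O`,
`(○^{n₁} L₁)^M ⊆ (○^{n₂} L₂)^M`. -/
def leadsTo (O : Ontology) (L₁ : Lit) (n₁ : ℤ) (L₂ : Lit) (n₂ : ℤ) : Prop :=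
  ∀ M : Itp, (∀ cl ∈ O, cl.holds M) →
    TC.sem M (TC.shift n₁ L₁.toTC) ⊆ TC.sem M (TC.shift n₂ L₂.toTC)


/-! ## Finite disjunctions, and relational primitive recursion as a fixed point -/

/-- The disjunction of a list of formulas. -/
def Fml.bigOr (l : List Fml) : Fml := l.foldr .or .falsum

theorem Fml.eval_bigOr (D : Set ℤ) (I : ℕ → Set ℤ) (l : List Fml) (env : ℕ → ℤ)
    (senv : ℕ → Set ℤ) (prev : ℕ → Prop) (Q : ℕ → ℤ → Prop) :
    Fml.eval D I (Fml.bigOr l) env senv prev Q ↔ ∃ φ ∈ l, Fml.eval D I φ env senv prev Q := by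
  induction l with
  | nil => simp [Fml.bigOr, Fml.eval]
  | cons φ l ih =>
    change Fml.eval D I φ env senv prev Q ∨ Fml.eval D I (Fml.bigOr l) env senv prev Q ↔ _
    simp [ih]

theorem Fml.isRPR_bigOr {l : List Fml} (h : ∀ φ ∈ l, φ.IsRPR) : (Fml.bigOr l).IsRPR := by
  induction l with
  | nil => trivial
  | cons φ l ih =>
    exact ⟨h φ (by simp), ih fun ψ hψ => h ψ (by simp [hψ])⟩

theorem Fml.fvars_bigOr {l : List Fml} {S : Set ℕ} (h : ∀ φ ∈ l, φ.fvars ⊆ S) :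
    (Fml.bigOr l).fvars ⊆ S := by
  induction l with
  | nil => exact Set.empty_subset S
  | cons φ l ih =>
    exact Set.union_subset (h φ (by simp)) (ih fun ψ hψ => h ψ (by simp [hψ]))

/-- Any family of predicates satisfying the recursion equations computes the
relations defined by relational primitive recursion. -/
theorem Fml.eval_rpr {D : Set ℤ} {I : ℕ → Set ℤ} {n : ℕ} {Θ : Fin n → Fml} {tv : ℕ} {ψ : Fml}
    {env : ℕ → ℤ} {senv : ℕ → Set ℤ} {prev : ℕ → Prop} {Q : ℕ → ℤ → Prop} (P : ℕ → Fin n → Prop)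
    (h0 : ∀ j, Fml.eval D I (Θ j) (Function.update env tv 0) senv (fun _ => False) Q ↔ P 0 j)
    (hs : ∀ (m : ℕ) j, Fml.eval D I (Θ j) (Function.update env tv ((m : ℤ) + 1)) senv
      (fun i => ∃ h : i < n, P m ⟨i, h⟩) Q ↔ P (m + 1) j) :
    Fml.eval D I (.rpr n Θ tv ψ) env senv prev Q ↔
      Fml.eval D I ψ env senv prev (fun j z => ∃ h : j < n, 0 ≤ z ∧ P z.toNat ⟨j, h⟩) := by
  have key : ∀ k : ℕ, (Nat.rec (motive := fun _ => Fin n → Prop)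
      (fun j => Fml.eval D I (Θ j) (Function.update env tv 0) senv (fun _ => False) Q)
      (fun m ih j => Fml.eval D I (Θ j) (Function.update env tv ((m : ℤ) + 1)) senv
        (fun i => ∃ h : i < n, ih ⟨i, h⟩) Q) k) = P k := by
    intro k
    induction k with
    | zero => exact funext fun j => propext (h0 j)
    | succ m ih =>
      refine funext fun j => propext ?_
      rw [← hs m j, ← ih]
  simp only [Fml.eval, key]

/-! ## Expressing the existence of runs of a finite automaton -/

/-- The formula defining the states `j` reachable at time `t` (the variable `1`) along runs that
avoid the blocked atoms `B` and satisfy `K` at the time given by the variable `0`. -/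
noncomputable def runStep {n : ℕ} (R : Fin n → Fin n → Prop) (B : Fin n → Finset ℕ)
    (K : Fin n → Prop) (j : Fin n) : Fml := by
  classical
  exact .and (.neg (Fml.bigOr ((B j).toList.map fun a => .atom a 1)))
    (.and (.or (.neg (.eq 1 0)) (if K j then .neg .falsum else .falsum))
      (.or (.neg (.ex 2 (.lt 2 1)))
        (Fml.bigOr (List.ofFn fun i : Fin n => if R i j then .qprev i else .falsum))))

/-- The formula stating that no run of the automaton reaches the last time point. -/
noncomputable def noRun {n : ℕ} (R : Fin n → Fin n → Prop) (B : Fin n → Finset ℕ)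
    (K : Fin n → Prop) : Fml :=
  .rpr n (runStep R B K) 1
    (.neg (.ex 1 (.and (.neg (.ex 2 (.lt 1 2)))
      (Fml.bigOr (List.ofFn fun i : Fin n => .qapp i 1)))))

theorem isRPR_noRun {n : ℕ} (R : Fin n → Fin n → Prop) (B : Fin n → Finset ℕ)
    (K : Fin n → Prop) : (noRun R B K).IsRPR := by
  refine ⟨fun j => ⟨Fml.isRPR_bigOr ?_, ⟨trivial, ?_⟩, trivial, Fml.isRPR_bigOr ?_⟩,
    trivial, Fml.isRPR_bigOr ?_⟩
  · simp only [List.mem_map]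
    rintro _ ⟨a, -, rfl⟩
    trivial
  · split_ifs <;> trivial
  · simp only [List.mem_ofFn]
    rintro _ ⟨i, rfl⟩
    split_ifs <;> trivial
  · simp only [List.mem_ofFn]
    rintro _ ⟨i, rfl⟩
    trivial

theorem fvars_runStep {n : ℕ} (R : Fin n → Fin n → Prop) (B : Fin n → Finset ℕ)
    (K : Fin n → Prop) (j : Fin n) : (runStep R B K j).fvars ⊆ {0, 1} := by
  refine Set.union_subset (Fml.fvars_bigOr ?_) (Set.union_subset (Set.union_subset ?_ ?_)
    (Set.union_subset ?_ (Fml.fvars_bigOr ?_)))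
  · simp only [List.mem_map]
    rintro _ ⟨a, -, rfl⟩
    simp [Fml.fvars]
  · intro x
    simp [Fml.fvars, or_comm]
  · split_ifs <;> simp [Fml.fvars]
  · intro x
    simp only [Fml.fvars, Set.mem_sdiff, Set.mem_insert_iff, Set.mem_singleton_iff]
    tauto
  · simp only [List.mem_ofFn]
    rintro _ ⟨i, rfl⟩
    split_ifs <;> simp [Fml.fvars]

theorem fvars_noRun {n : ℕ} (R : Fin n → Fin n → Prop) (B : Fin n → Finset ℕ)
    (K : Fin n → Prop) : (noRun R B K).fvars ⊆ {0} := by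
  refine Set.union_subset (Set.iUnion_subset fun j => ?_) ?_
  · rintro x ⟨hx, hx1⟩
    have := fvars_runStep R B K j hx
    simp only [Set.mem_insert_iff, Set.mem_singleton_iff] at this hx1 ⊢
    tauto
  · have h : (Fml.bigOr (List.ofFn fun i : Fin n => Fml.qapp i 1)).fvars ⊆ {1} := by
      refine Fml.fvars_bigOr ?_
      simp only [List.mem_ofFn]
      rintro _ ⟨i, rfl⟩
      simp [Fml.fvars]
    rintro x ⟨hx, hx1⟩
    rcases hx with hx | hx
    · simp only [Fml.fvars, Set.mem_sdiff, Set.mem_insert_iff, Set.mem_singleton_iff] at hx hx1 ⊢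
      tauto
    · exact absurd (h hx) hx1

theorem eval_runStep {n : ℕ} (R : Fin n → Fin n → Prop) (B : Fin n → Finset ℕ)
    (K : Fin n → Prop) (j : Fin n) (D : Set ℤ) (I : ℕ → Set ℤ) (env : ℕ → ℤ)
    (senv : ℕ → Set ℤ) (prev : ℕ → Prop) (Q : ℕ → ℤ → Prop) :
    Fml.eval D I (runStep R B K j) env senv prev Q ↔
      ((∀ a ∈ B j, env 1 ∉ I a) ∧ (env 1 = env 0 → K j)) ∧
        ((∀ d ∈ D, env 1 ≤ d) ∨ ∃ i, R i j ∧ prev i) := by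
  classical
  have h1 : (∃ i : Fin n, Fml.eval D I (if R i j then .qprev i else .falsum) env senv prev Q) ↔
      ∃ i, R i j ∧ prev i := by
    refine exists_congr fun i => ?_
    by_cases h : R i j <;> simp [h, Fml.eval]
  have h2 : Fml.eval D I (if K j then .neg .falsum else .falsum) env senv prev Q ↔ K j := by
    by_cases h : K j <;> simp [h, Fml.eval]
  simp only [runStep, Fml.eval, Fml.eval_bigOr, List.mem_map, List.mem_ofFn, exists_exists_eq_and,
    h1, h2, Finset.mem_toList, and_assoc]
  simp [Fml.eval, imp_iff_not_or]

/-- The states at the end of a run over the time points `0, …, k`. -/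
def Reach {n : ℕ} (R : Fin n → Fin n → Prop) (good : ℕ → Fin n → Prop) (k : ℕ) (j : Fin n) :
    Prop :=
  ∃ τ : ℕ → Fin n, τ k = j ∧ (∀ i < k, R (τ i) (τ (i + 1))) ∧ ∀ i ≤ k, good i (τ i)

theorem reach_zero {n : ℕ} (R : Fin n → Fin n → Prop) (good : ℕ → Fin n → Prop) (j : Fin n) :
    Reach R good 0 j ↔ good 0 j := by
  constructor
  · rintro ⟨τ, rfl, -, h⟩
    exact h 0 le_rfl
  · intro h
    refine ⟨fun _ => j, rfl, by simp, fun i hi => ?_⟩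
    obtain rfl : i = 0 := by omega
    exact h

theorem reach_succ {n : ℕ} (R : Fin n → Fin n → Prop) (good : ℕ → Fin n → Prop) (m : ℕ)
    (j : Fin n) :
    Reach R good (m + 1) j ↔ good (m + 1) j ∧ ∃ i, R i j ∧ Reach R good m i := by
  constructor
  · rintro ⟨τ, rfl, hR, hg⟩
    exact ⟨hg _ le_rfl, τ m, hR m (by omega), τ, rfl, fun i hi => hR i (by omega),
      fun i hi => hg i (by omega)⟩
  · rintro ⟨hj, _, hRj, τ, rfl, hR, hg⟩
    refine ⟨fun i => if i ≤ m then τ i else j, by simp, fun i hi => ?_, fun i hi => ?_⟩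
    · rcases Nat.lt_succ_iff_lt_or_eq.1 hi with h | rfl
      · simpa [h.le, Nat.succ_le_of_lt h] using hR i h
      · simpa using hRj
    · by_cases h : i ≤ m
      · simpa [h] using hg i h
      · obtain rfl : i = m + 1 := by omega
        simpa using hj

theorem DataInstance.minT_eq (A : DataInstance) : A.minT = 0 := by
  apply le_antisymm
  · obtain ⟨p, hp, h⟩ := A.has_zero
    exact h ▸ Finset.min'_le _ _ (Finset.mem_image_of_mem _ hp)
  · refine Finset.le_min' _ _ _ fun y hy => ?_
    obtain ⟨p, hp, rfl⟩ := Finset.mem_image.1 hy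
    exact A.nonneg p hp

theorem DataInstance.le_maxT (A : DataInstance) {p : ℕ × ℤ} (hp : p ∈ A.atoms) : p.2 ≤ A.maxT :=
  Finset.le_max' _ _ (Finset.mem_image_of_mem _ hp)

theorem DataInstance.one_le_maxT (A : DataInstance) : 1 ≤ A.maxT := by
  obtain ⟨p, hp, h⟩ := A.has_one
  exact h.trans (A.le_maxT hp)

theorem DataInstance.mem_tem (A : DataInstance) (d : ℤ) : d ∈ A.tem ↔ 0 ≤ d ∧ d ≤ A.maxT := by
  rw [DataInstance.tem, A.minT_eq, Set.mem_Icc]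

theorem eval_noRun {n : ℕ} (R : Fin n → Fin n → Prop) (B : Fin n → Finset ℕ)
    (K : Fin n → Prop) (A : DataInstance) (ℓ : ℤ) :
    Fml.evalIn A.tem A.itp (noRun R B K) (fun _ => ℓ) ↔
      ¬ ∃ j, Reach R (fun i s => (∀ a ∈ B s, (a, (i : ℤ)) ∉ A.atoms) ∧ ((i : ℤ) = ℓ → K s))
        A.maxT.toNat j := by
  have hpos := A.one_le_maxT
  rw [Fml.evalIn, noRun, Fml.eval_rpr
    (Reach R (fun i s => (∀ a ∈ B s, (a, (i : ℤ)) ∉ A.atoms) ∧ ((i : ℤ) = ℓ → K s)))]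
  · simp only [Fml.eval, Fml.eval_bigOr, List.mem_ofFn, exists_exists_eq_and, Fin.is_lt,
      Function.update_self, exists_true_left, Fin.eta]
    refine not_congr ⟨?_, ?_⟩
    · rintro ⟨d, hd, hmax, j, -, hj⟩
      rw [A.mem_tem] at hd
      obtain rfl : d = A.maxT := by
        by_contra hne
        refine hmax ⟨A.maxT, (A.mem_tem _).2 ⟨by omega, le_rfl⟩, ?_⟩
        simp
        omega
      exact ⟨j, hj⟩
    · rintro ⟨j, hj⟩
      refine ⟨A.maxT, (A.mem_tem _).2 ⟨by omega, le_rfl⟩, ?_, j, by omega, hj⟩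
      rintro ⟨d, hd, hlt⟩
      rw [A.mem_tem] at hd
      simp at hlt
      omega
  · intro j
    rw [eval_runStep, reach_zero]
    have : ∀ d ∈ A.tem, (0 : ℤ) ≤ d := fun d hd => ((A.mem_tem d).1 hd).1
    simpa [DataInstance.itp] using fun _ _ => this
  · intro m j
    have h : ¬ ∀ d ∈ A.tem, (m : ℤ) < d := fun h => by
      have := h 0 ((A.mem_tem 0).2 ⟨le_rfl, by omega⟩)
      omega
    rw [eval_runStep, reach_succ]
    simp [DataInstance.itp, h]

/-! ## Shifting and gluing interpretations -/

theorem TC.sem_shift (M : Itp) (k : ℤ) (C : TC) (n : ℤ) :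
    n ∈ TC.sem (fun a => {n | n + k ∈ M a}) C ↔ n + k ∈ TC.sem M C := by
  induction C generalizing n with
  | top => simp [TC.sem]
  | atom a => simp [TC.sem]
  | neg C ih => simp [TC.sem, ih]
  | and C D ihC ihD => simp [TC.sem, ihC, ihD]
  | or C D ihC ihD => simp [TC.sem, ihC, ihD]
  | nextF C ih => simp [TC.sem, ih, add_right_comm]
  | nextP C ih => simp [TC.sem, ih, add_sub_right_comm]
  | diamF C ih | diamP C ih =>
    exact (Equiv.addRight k).exists_congr fun m => and_congr (by simp) (ih m)
  | boxF C ih | boxP C ih =>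
    exact (Equiv.addRight k).forall_congr fun m => imp_congr (by simp) (ih m)
  | untl C D ihC ihD | since C D ihC ihD =>
    exact (Equiv.addRight k).exists_congr fun m => and_congr (by simp) <| and_congr (ihD m) <|
      (Equiv.addRight k).forall_congr fun l => imp_congr (by simp) <|
        imp_congr (by simp) (ihC l)

theorem TC.self_mem_subs (C : TC) : C ∈ C.subs := by
  cases C <;> simp [TC.subs]

theorem TC.subs_subset_of_mem {C D : TC} (h : D ∈ C.subs) : D.subs ⊆ C.subs := by
  induction C with
  | top => simp_all [TC.subs]
  | atom a => simp_all [TC.subs]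
  | and C₁ C₂ ih₁ ih₂ | or C₁ C₂ ih₁ ih₂ | untl C₁ C₂ ih₁ ih₂ | since C₁ C₂ ih₁ ih₂ =>
    rcases h with rfl | h | h
    · rfl
    · exact (ih₁ h).trans fun x hx => .inr (.inl hx)
    · exact (ih₂ h).trans fun x hx => .inr (.inr hx)
  | _ C₁ ih =>
    rcases h with rfl | h
    · rfl
    · exact (ih h).trans fun x hx => .inr hx

theorem TC.finite_subs (C : TC) : C.subs.Finite := by
  induction C with
  | top => exact Set.finite_singleton _
  | atom a => exact Set.finite_singleton _
  | and C₁ C₂ ih₁ ih₂ | or C₁ C₂ ih₁ ih₂ | untl C₁ C₂ ih₁ ih₂ | since C₁ C₂ ih₁ ih₂ =>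
    exact (ih₁.union ih₂).insert _
  | _ C₁ ih => exact ih.insert _

theorem Ontology.finite_subs (O : Ontology) : O.subs.Finite := by
  have h : O.subs = ⋃ cl ∈ {cl | cl ∈ O}, ⋃ D ∈ {D | D ∈ cl.prem ++ cl.concl}, D.subs := by
    ext C
    simp [Ontology.subs]
  rw [h]
  exact (List.finite_toSet O).biUnion fun cl _ =>
    (List.finite_toSet _).biUnion fun D _ => D.finite_subs

theorem TC.sem_congr {M M' : Itp} {C : TC} (h : ∀ a, .atom a ∈ C.subs → M a = M' a) :
    TC.sem M C = TC.sem M' C := by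
  induction C with
  | top => rfl
  | atom a => exact h a rfl
  | and C₁ C₂ ih₁ ih₂ | or C₁ C₂ ih₁ ih₂ | untl C₁ C₂ ih₁ ih₂ | since C₁ C₂ ih₁ ih₂ =>
    simp only [TC.sem, ih₁ fun a ha => h a (.inr (.inl ha)),
      ih₂ fun a ha => h a (.inr (.inr ha))]
  | _ C₁ ih => simp only [TC.sem, ih fun a ha => h a (.inr ha)]

/-- The interpretation that agrees with `M₁` up to `p` and with `M₂` after `p`. -/
def glue (M₁ M₂ : Itp) (p : ℤ) : Itp := fun a => {n | n ≤ p ∧ n ∈ M₁ a ∨ p < n ∧ n ∈ M₂ a}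

theorem until_split (S T : Set ℤ) {n p : ℤ} (h : n < p) :
    (∃ k, n < k ∧ k ∈ T ∧ ∀ m, n < m → m < k → m ∈ S) ↔
      (∃ k, k ≤ p ∧ n < k ∧ k ∈ T ∧ ∀ m ≤ p, n < m → m < k → m ∈ S) ∨
        (∀ m ≤ p, n < m → m ∈ S) ∧ ∃ k, p < k ∧ k ∈ T ∧ ∀ m, p < m → m < k → m ∈ S := by
  constructor
  · rintro ⟨k, hk, hT, hS⟩
    rcases le_or_gt k p with hkp | hkp
    · exact .inl ⟨k, hkp, hk, hT, fun m _ => hS m⟩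
    · exact .inr ⟨fun m hm hn => hS m hn (by omega), k, hkp, hT, fun m hm => hS m (by omega)⟩
  · rintro (⟨k, hkp, hk, hT, hS⟩ | ⟨hS, k, hk, hT, hS'⟩)
    · exact ⟨k, hk, hT, fun m hn hm => hS m (by omega) hn hm⟩
    · refine ⟨k, by omega, hT, fun m hn hm => ?_⟩
      rcases le_or_gt m p with hmp | hmp
      · exact hS m hmp hn
      · exact hS' m hmp hm

theorem since_split (S T : Set ℤ) {n p : ℤ} (h : p < n) :
    (∃ k, k < n ∧ k ∈ T ∧ ∀ m, k < m → m < n → m ∈ S) ↔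
      (∃ k, p ≤ k ∧ k < n ∧ k ∈ T ∧ ∀ m, p ≤ m → k < m → m < n → m ∈ S) ∨
        (∀ m, p ≤ m → m < n → m ∈ S) ∧ ∃ k, k < p ∧ k ∈ T ∧ ∀ m, k < m → m < p → m ∈ S := by
  constructor
  · rintro ⟨k, hk, hT, hS⟩
    rcases le_or_gt p k with hkp | hkp
    · exact .inl ⟨k, hkp, hk, hT, fun m _ => hS m⟩
    · exact .inr ⟨fun m hm hn => hS m (by omega) hn, k, hkp, hT,
        fun m hm hp => hS m hm (by omega)⟩
  · rintro (⟨k, hkp, hk, hT, hS⟩ | ⟨hS, k, hk, hT, hS'⟩)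
    · exact ⟨k, hk, hT, fun m hn hm => hS m (by omega) hn hm⟩
    · refine ⟨k, by omega, hT, fun m hn hm => ?_⟩
      rcases le_or_gt p m with hmp | hmp
      · exact hS m hmp hm
      · exact hS' m hn hmp

theorem TC.sem_diamF (M : Itp) (C : TC) :
    TC.sem M (.diamF C) = TC.sem M (.untl .top C) := by
  ext n
  simp [TC.sem]

theorem TC.sem_diamP (M : Itp) (C : TC) :
    TC.sem M (.diamP C) = TC.sem M (.since .top C) := by
  ext n
  simp [TC.sem]

theorem TC.sem_boxF (M : Itp) (C : TC) :
    TC.sem M (.boxF C) = (TC.sem M (.untl .top (.neg C)))ᶜ := by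
  ext n
  simp [TC.sem]

theorem TC.sem_boxP (M : Itp) (C : TC) :
    TC.sem M (.boxP C) = (TC.sem M (.since .top (.neg C)))ᶜ := by
  ext n
  simp [TC.sem]

/-- `C` has the same extension in `M` as in `M₁` up to `p` and as in `M₂` from `p` on. -/
def Agrees (M M₁ M₂ : Itp) (p : ℤ) (C : TC) : Prop :=
  ∀ n, (n ≤ p → (n ∈ TC.sem M C ↔ n ∈ TC.sem M₁ C)) ∧
    (p ≤ n → (n ∈ TC.sem M C ↔ n ∈ TC.sem M₂ C))

theorem Agrees.untl {M M₁ M₂ : Itp} {p : ℤ} {C D : TC} (hC : Agrees M M₁ M₂ p C)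
    (hD : Agrees M M₁ M₂ p D)
    (h : p ∈ TC.sem M₁ (.untl C D) ↔ p ∈ TC.sem M₂ (.untl C D)) :
    Agrees M M₁ M₂ p (.untl C D) := by
  have right : ∀ n, p ≤ n → (n ∈ TC.sem M (.untl C D) ↔ n ∈ TC.sem M₂ (.untl C D)) := by
    refine fun n hn => exists_congr fun k => and_congr_right fun hk => ?_
    rw [(hD k).2 (by omega)]
    refine and_congr_right fun _ => forall_congr' fun m => imp_congr_right fun hm => ?_
    rw [(hC m).2 (by omega)]
  have mid : p ∈ TC.sem M (.untl C D) ↔ p ∈ TC.sem M₁ (.untl C D) :=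
    (right p le_rfl).trans h.symm
  refine fun n => ⟨fun hn => ?_, right n⟩
  rcases hn.eq_or_lt with rfl | hn
  · exact mid
  refine (until_split _ _ hn).trans (Iff.trans ?_ (until_split _ _ hn).symm)
  refine or_congr (exists_congr fun k => and_congr_right fun hk => and_congr_right fun _ =>
    and_congr ((hD k).1 hk) ?_) (and_congr ?_ mid)
  · exact forall_congr' fun m => imp_congr_right fun hm => by rw [(hC m).1 hm]
  · exact forall_congr' fun m => imp_congr_right fun hm => by rw [(hC m).1 hm]

theorem Agrees.since {M M₁ M₂ : Itp} {p : ℤ} {C D : TC} (hC : Agrees M M₁ M₂ p C)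
    (hD : Agrees M M₁ M₂ p D)
    (h : p ∈ TC.sem M₁ (.since C D) ↔ p ∈ TC.sem M₂ (.since C D)) :
    Agrees M M₁ M₂ p (.since C D) := by
  have left : ∀ n, n ≤ p → (n ∈ TC.sem M (.since C D) ↔ n ∈ TC.sem M₁ (.since C D)) := by
    refine fun n hn => exists_congr fun k => and_congr_right fun hk => ?_
    rw [(hD k).1 (by omega)]
    refine and_congr_right fun _ => forall_congr' fun m => imp_congr_right fun _ =>
      imp_congr_right fun hm => ?_
    rw [(hC m).1 (by omega)]
  have mid : p ∈ TC.sem M (.since C D) ↔ p ∈ TC.sem M₂ (.since C D) :=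
    (left p le_rfl).trans h
  refine fun n => ⟨left n, fun hn => ?_⟩
  rcases hn.eq_or_lt with rfl | hn
  · exact mid
  refine (since_split _ _ hn).trans (Iff.trans ?_ (since_split _ _ hn).symm)
  refine or_congr (exists_congr fun k => and_congr_right fun hk => and_congr_right fun _ =>
    and_congr ((hD k).2 hk) ?_) (and_congr ?_ mid)
  · exact forall_congr' fun m => imp_congr_right fun hm => by rw [(hC m).2 hm]
  · exact forall_congr' fun m => imp_congr_right fun hm => by rw [(hC m).2 hm]

theorem Agrees.top (M M₁ M₂ : Itp) (p : ℤ) : Agrees M M₁ M₂ p .top := fun n => by simp [TC.sem]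

theorem Agrees.neg {M M₁ M₂ : Itp} {p : ℤ} {C : TC} (hC : Agrees M M₁ M₂ p C) :
    Agrees M M₁ M₂ p (.neg C) :=
  fun n => ⟨fun hn => not_congr ((hC n).1 hn), fun hn => not_congr ((hC n).2 hn)⟩

/-- If `M₁` and `M₂` have the same type at `p`, gluing them at `p` preserves all types. -/
theorem agrees_glue {M₁ M₂ : Itp} {p : ℤ} {C : TC}
    (h : ∀ D ∈ C.subs, (p ∈ TC.sem M₁ D ↔ p ∈ TC.sem M₂ D)) :
    Agrees (glue M₁ M₂ p) M₁ M₂ p C := by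
  have hself := h C C.self_mem_subs
  induction C with
  | top => exact Agrees.top _ _ _ _
  | atom a =>
    intro n
    simp only [TC.sem] at hself
    refine ⟨fun hn => ?_, fun hn => ?_⟩
    · simp [TC.sem, glue, hn, hn.not_gt]
    · rcases hn.eq_or_lt with rfl | hn
      · simp [TC.sem, glue, hself]
      · simp [TC.sem, glue, hn, hn.not_ge]
  | neg C ih =>
    exact (ih (fun D hD => h D (.inr hD)) (h C (.inr C.self_mem_subs))).neg
  | and C D ihC ihD =>
    have hC := ihC (fun E hE => h E (.inr (.inl hE))) (h C (.inr (.inl C.self_mem_subs)))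
    have hD := ihD (fun E hE => h E (.inr (.inr hE))) (h D (.inr (.inr D.self_mem_subs)))
    exact fun n => ⟨fun hn => and_congr ((hC n).1 hn) ((hD n).1 hn),
      fun hn => and_congr ((hC n).2 hn) ((hD n).2 hn)⟩
  | or C D ihC ihD =>
    have hC := ihC (fun E hE => h E (.inr (.inl hE))) (h C (.inr (.inl C.self_mem_subs)))
    have hD := ihD (fun E hE => h E (.inr (.inr hE))) (h D (.inr (.inr D.self_mem_subs)))
    exact fun n => ⟨fun hn => or_congr ((hC n).1 hn) ((hD n).1 hn),
      fun hn => or_congr ((hC n).2 hn) ((hD n).2 hn)⟩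
  | untl C D ihC ihD =>
    exact (ihC (fun E hE => h E (.inr (.inl hE))) (h C (.inr (.inl C.self_mem_subs)))).untl
      (ihD (fun E hE => h E (.inr (.inr hE))) (h D (.inr (.inr D.self_mem_subs)))) hself
  | since C D ihC ihD =>
    exact (ihC (fun E hE => h E (.inr (.inl hE))) (h C (.inr (.inl C.self_mem_subs)))).since
      (ihD (fun E hE => h E (.inr (.inr hE))) (h D (.inr (.inr D.self_mem_subs)))) hself
  | nextF C ih =>
    have hC := ih (fun D hD => h D (.inr hD)) (h C (.inr C.self_mem_subs))
    refine fun n => ⟨fun hn => ?_, fun hn => (hC (n + 1)).2 (by omega)⟩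
    rcases hn.eq_or_lt with rfl | hn
    · exact ((hC (n + 1)).2 (by omega)).trans hself.symm
    · exact (hC (n + 1)).1 (by omega)
  | nextP C ih =>
    have hC := ih (fun D hD => h D (.inr hD)) (h C (.inr C.self_mem_subs))
    refine fun n => ⟨fun hn => (hC (n - 1)).1 (by omega), fun hn => ?_⟩
    rcases hn.eq_or_lt with rfl | hn
    · exact ((hC (p - 1)).1 (by omega)).trans hself
    · exact (hC (n - 1)).2 (by omega)
  | diamF C ih =>
    have hC := ih (fun D hD => h D (.inr hD)) (h C (.inr C.self_mem_subs))
    simp only [TC.sem_diamF] at hself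
    simpa only [Agrees, TC.sem_diamF] using (Agrees.top _ _ _ _).untl hC hself
  | diamP C ih =>
    have hC := ih (fun D hD => h D (.inr hD)) (h C (.inr C.self_mem_subs))
    simp only [TC.sem_diamP] at hself
    simpa only [Agrees, TC.sem_diamP] using (Agrees.top _ _ _ _).since hC hself
  | boxF C ih =>
    have hC := ih (fun D hD => h D (.inr hD)) (h C (.inr C.self_mem_subs))
    simp only [TC.sem_boxF, Set.mem_compl_iff, not_iff_not] at hself
    simpa only [Agrees, TC.sem_boxF, Set.mem_compl_iff, not_iff_not]
      using (Agrees.top _ _ _ _).untl hC.neg hself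
  | boxP C ih =>
    have hC := ih (fun D hD => h D (.inr hD)) (h C (.inr C.self_mem_subs))
    simp only [TC.sem_boxP, Set.mem_compl_iff, not_iff_not] at hself
    simpa only [Agrees, TC.sem_boxP, Set.mem_compl_iff, not_iff_not]
      using (Agrees.top _ _ _ _).since hC.neg hself

/-! ## Types and runs -/

/-- The type of a time point: the set of concepts from `Γ` true at it. -/
def typeAt (Γ : Set TC) (M : Itp) (n : ℤ) : Set Γ := {C | n ∈ TC.sem M C.1}

theorem mem_sem_iff_of_typeAt_eq {Γ : Set TC} {M M' : Itp} {n n' : ℤ}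
    (h : typeAt Γ M n = typeAt Γ M' n') {C : TC} (hC : C ∈ Γ) :
    n ∈ TC.sem M C ↔ n' ∈ TC.sem M' C := by
  have : (⟨C, hC⟩ : Γ) ∈ typeAt Γ M n ↔ (⟨C, hC⟩ : Γ) ∈ typeAt Γ M' n' := by rw [h]
  exact this

theorem typeAt_shift (Γ : Set TC) (M : Itp) (k n : ℤ) :
    typeAt Γ (fun a => {n | n + k ∈ M a}) n = typeAt Γ M (n + k) := by
  ext C
  exact TC.sem_shift M k C.1 n

theorem holds_of_typeAt {Γ : Set TC} {cl : Clause} (hΓ : ∀ C ∈ cl.prem ++ cl.concl, C ∈ Γ)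
    {M : Itp}
    (h : ∀ n, ∃ M' n', cl.holds M' ∧ typeAt Γ M n = typeAt Γ M' n') : cl.holds M := by
  intro n hn
  obtain ⟨M', n', hM', ht⟩ := h n
  obtain ⟨C, hC, hs⟩ := hM' n' fun C hC =>
    (mem_sem_iff_of_typeAt_eq ht (hΓ C (by simp [hC]))).1 (hn C hC)
  exact ⟨C, hC, (mem_sem_iff_of_typeAt_eq ht (hΓ C (by simp [hC]))).2 hs⟩

/-- The types `s` and `t` occur at consecutive time points of some model of `O`. -/
def Consecutive (O : Ontology) (Γ : Set TC) (s t : Set Γ) : Prop :=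
  ∃ M : Itp, (∀ cl ∈ O, cl.holds M) ∧ ∃ n : ℤ, typeAt Γ M n = s ∧ typeAt Γ M (n + 1) = t

theorem Consecutive.exists_at {O : Ontology} {Γ : Set TC} (hO : O.subs ⊆ Γ) {s t : Set Γ}
    (h : Consecutive O Γ s t) (p : ℤ) :
    ∃ M : Itp, (∀ cl ∈ O, cl.holds M) ∧ typeAt Γ M p = s ∧ typeAt Γ M (p + 1) = t := by
  obtain ⟨M, hM, n, rfl, rfl⟩ := h
  refine ⟨fun a => {m | m + (n - p) ∈ M a}, fun cl hcl => ?_, ?_, ?_⟩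
  · refine holds_of_typeAt (Γ := Γ) (fun C hC => hO ⟨cl, hcl, C, by simpa using hC,
      C.self_mem_subs⟩) fun m => ⟨M, m + (n - p), hM cl hcl, typeAt_shift Γ M _ m⟩
  · rw [typeAt_shift]
    congr 1
    omega
  · rw [typeAt_shift]
    congr 1
    omega

/-- Every sequence of pairwise consecutive types is realized in a model. -/
theorem exists_model_of_consecutive {O : Ontology} {Γ : Set TC} (hO : O.subs ⊆ Γ)
    (hΓ : ∀ C ∈ Γ, C.subs ⊆ Γ) (τ : ℕ → Set Γ) (N : ℕ)
    (hτ : ∀ i < N + 1, Consecutive O Γ (τ i) (τ (i + 1))) :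
    ∃ M : Itp, (∀ cl ∈ O, cl.holds M) ∧ ∀ i ≤ N + 1, typeAt Γ M i = τ i := by
  induction N with
  | zero =>
    obtain ⟨M, hM, h0, h1⟩ := (hτ 0 (by omega)).exists_at hO 0
    refine ⟨M, hM, fun i hi => ?_⟩
    interval_cases i
    · exact h0
    · exact h1
  | succ N ih =>
    obtain ⟨M₁, hM₁, h₁⟩ := ih fun i hi => hτ i (by omega)
    obtain ⟨M₂, hM₂, h₂, h₂'⟩ := (hτ (N + 1) (by omega)).exists_at hO ((N + 1 : ℕ) : ℤ)
    have hp : typeAt Γ M₁ ((N + 1 : ℕ) : ℤ) = typeAt Γ M₂ ((N + 1 : ℕ) : ℤ) :=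
      (h₁ _ le_rfl).trans h₂.symm
    have hag : ∀ C ∈ Γ, Agrees (glue M₁ M₂ ((N + 1 : ℕ) : ℤ)) M₁ M₂ ((N + 1 : ℕ) : ℤ) C :=
      fun C hC => agrees_glue fun D hD => mem_sem_iff_of_typeAt_eq hp (hΓ C hC hD)
    have left : ∀ n ≤ ((N + 1 : ℕ) : ℤ),
        typeAt Γ (glue M₁ M₂ ((N + 1 : ℕ) : ℤ)) n = typeAt Γ M₁ n :=
      fun n hn => Set.ext fun C => (hag C.1 C.2 n).1 hn
    have right : ∀ n ≥ ((N + 1 : ℕ) : ℤ),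
        typeAt Γ (glue M₁ M₂ ((N + 1 : ℕ) : ℤ)) n = typeAt Γ M₂ n :=
      fun n hn => Set.ext fun C => (hag C.1 C.2 n).2 hn
    refine ⟨glue M₁ M₂ ((N + 1 : ℕ) : ℤ), fun cl hcl => ?_, fun i hi => ?_⟩
    · refine holds_of_typeAt (Γ := Γ) (fun C hC => hO ⟨cl, hcl, C, by simpa using hC,
        C.self_mem_subs⟩) fun n => ?_
      rcases le_total n ((N + 1 : ℕ) : ℤ) with hn | hn
      · exact ⟨M₁, n, hM₁ cl hcl, left n hn⟩
      · exact ⟨M₂, n, hM₂ cl hcl, right n hn⟩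
    · rcases Nat.le_or_eq_of_le_succ hi with hi | rfl
      · rw [left _ (by omega), h₁ i hi]
      · rw [right _ (by push_cast; omega)]
        exact_mod_cast h₂'

/-- A model avoiding `κ` at `ℓ` exists iff there is a run through types
that is compatible with the data and avoids `κ` at `ℓ`. -/
theorem exists_model_iff_exists_run {O : Ontology} {κ : TC} {Γ : Set TC} (hO : O.subs ⊆ Γ)
    (hκ : κ ∈ Γ) (hΓ : ∀ C ∈ Γ, C.subs ⊆ Γ) (A : DataInstance) {ℓ : ℤ} (hℓ : ℓ ∈ A.tem) :
    (∃ M, IsModel M O A ∧ ℓ ∉ TC.sem M κ) ↔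
      ∃ τ : ℕ → Set Γ, (∀ i < A.maxT.toNat, Consecutive O Γ (τ i) (τ (i + 1))) ∧
        ∀ i ≤ A.maxT.toNat,
          (∀ a, ∀ h : .atom a ∈ Γ, (a, (i : ℤ)) ∈ A.atoms → (⟨.atom a, h⟩ : Γ) ∈ τ i) ∧
          ((i : ℤ) = ℓ → (⟨κ, hκ⟩ : Γ) ∉ τ i) := by
  constructor
  · rintro ⟨M, ⟨hM, hA⟩, hκM⟩
    refine ⟨fun i => typeAt Γ M i, fun i _ => ⟨M, hM, i, rfl, ?_⟩, fun i _ => ⟨?_, ?_⟩⟩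
    · push_cast
      rfl
    · exact fun a _ ha => hA _ ha
    · rintro rfl
      exact hκM
  · rintro ⟨τ, hR, hg⟩
    have hpos := A.one_le_maxT
    obtain ⟨N, hN⟩ : ∃ N, A.maxT.toNat = N + 1 := ⟨A.maxT.toNat - 1, by omega⟩
    rw [hN] at hR hg
    obtain ⟨M, hM, hτ⟩ := exists_model_of_consecutive hO hΓ τ N hR
    rw [A.mem_tem] at hℓ
    have hsem : ∀ C ∈ Γ, TC.sem (fun a => M a ∪ {_n | .atom a ∉ Γ}) C = TC.sem M C :=
      fun C hC => TC.sem_congr fun a ha => by simp [hΓ C hC ha]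
    refine ⟨fun a => M a ∪ {_n | .atom a ∉ Γ}, ⟨fun cl hcl => ?_, fun p hp => ?_⟩, ?_⟩
    · refine holds_of_typeAt (Γ := Γ) (fun C hC => hO ⟨cl, hcl, C, by simpa using hC,
        C.self_mem_subs⟩) fun n => ⟨M, n, hM cl hcl, Set.ext fun C => ?_⟩
      change n ∈ TC.sem _ _ ↔ n ∈ TC.sem _ _
      rw [hsem C.1 C.2]
    · by_cases ha : TC.atom p.1 ∈ Γ
      · have h0 := A.nonneg p hp
        have h1 := A.le_maxT hp
        have hp2 : ((p.2.toNat : ℕ) : ℤ) = p.2 := Int.toNat_of_nonneg h0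
        have h := (hg p.2.toNat (by omega)).1 p.1 ha (by rwa [hp2])
        rw [← hτ p.2.toNat (by omega), hp2] at h
        exact .inl h
      · exact .inr ha
    · have hl : ((ℓ.toNat : ℕ) : ℤ) = ℓ := Int.toNat_of_nonneg hℓ.1
      have h := (hg ℓ.toNat (by omega)).2 hl
      rw [← hτ ℓ.toNat (by omega), hl] at h
      rw [hsem κ hκ]
      exact h

/-- Theorem: FO(RPR)-rewritability of LTL_bool^□○ OMIQs.
Every OMIQ `(O, κ)` with an LTL_bool^□○ ontology `O` and an arbitrary temporal
concept `κ` is FO(RPR)-rewritable. -/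
theorem boolBoxNext_OMIQ_FORPR_rewritable (O : Ontology) (hO : O.BoolBoxNext) (κ : TC) :
    ∃ φ : Fml, φ.IsRPR ∧ φ.fvars ⊆ {0} ∧
      ∀ A : DataInstance,
        certAns O κ A = {ℓ ∈ A.tem | Fml.evalIn A.tem A.itp φ (fun _ => ℓ)} := by
  let Γ : Set TC := O.subs ∪ κ.subs
  have hOΓ : O.subs ⊆ Γ := Set.subset_union_left
  have hκ : κ ∈ Γ := .inr κ.self_mem_subs
  have hΓ : ∀ C ∈ Γ, C.subs ⊆ Γ := by
    rintro C (⟨cl, hcl, D, hD, hC⟩ | hC)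
    · exact fun E hE => .inl ⟨cl, hcl, D, hD, TC.subs_subset_of_mem hC hE⟩
    · exact fun E hE => .inr (TC.subs_subset_of_mem hC hE)
  have hfin : Γ.Finite := O.finite_subs.union κ.finite_subs
  have : Finite Γ := hfin
  obtain ⟨n, ⟨e⟩⟩ := Finite.exists_equiv_fin (Set Γ)
  have hB (j : Fin n) : {a | ∃ h : TC.atom a ∈ Γ, (⟨.atom a, h⟩ : Γ) ∉ e.symm j}.Finite :=
    (hfin.preimage (f := TC.atom) (fun a _ b _ h => by simpa using h)).subset
      fun a ⟨h, _⟩ => h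
  refine ⟨noRun (fun i j => Consecutive O Γ (e.symm i) (e.symm j)) (fun j => (hB j).toFinset)
    (fun j => (⟨κ, hκ⟩ : Γ) ∉ e.symm j), isRPR_noRun _ _ _, fvars_noRun _ _ _, fun A => ?_⟩
  refine Set.ext fun ℓ => and_congr_right fun hℓ => ?_
  rw [eval_noRun, ← not_iff_not, not_not]
  push Not
  rw [exists_model_iff_exists_run hOΓ hκ hΓ A hℓ]
  constructor
  · rintro ⟨τ, hR, hg⟩
    refine ⟨_, fun i => e (τ i), rfl, by simpa using hR, fun i hi => ⟨fun a ha hA => ?_, ?_⟩⟩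
    · obtain ⟨h, hn⟩ := (hB _).mem_toFinset.1 ha
      exact hn (by simpa using (hg i hi).1 a h hA)
    · simpa using (hg i hi).2
  · rintro ⟨_, τ, -, hR, hg⟩
    refine ⟨fun i => e.symm (τ i), hR, fun i hi => ⟨fun a h hA => ?_, (hg i hi).2⟩⟩
    by_contra hn
    exact (hg i hi).1 a ((hB _).mem_toFinset.2 ⟨h, hn⟩) hA

end LTLOMQ
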